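/- Let −3 < γ ≤ 1, θ_M > 0, 1/2 < α₀ < 1, and c₁, c₂, C₀ > 0. Let μ_ε: ℝ³ → (0,∞) be measurable with c₁ μ_M(v) ≤ μ_ε(v) ≤ c₂ (μ_M(v))^{α₀} for all v, where μ_M(v) = (2πθ_M)^{-3/2} exp(−|v|²/(2θ_M)). Let b̃: [−1,1] → [0,∞) be measurable with b̃(s) ≤ C₀|s|, and for 0 < m ≤ 1 let Υ_m: [0,∞) → [0,1] be measurable with Υ_m(s) = 1 for s ≤ m and Υ_m(s) = 0 for s ≥ 2m. For v, v₁ ∈ ℝ³ and ω ∈ S² set v' = v − ((v−v₁)·ω)ω and v₁' = v₁ + ((v−v₁)·ω)ω, and for bounded measurable g: ℝ³ → ℝ define K^m g(v) = ∫_{ℝ³}∫_{S²} b̃(((v−v₁)·ω)/|v−v₁|) Υ_m(|v₁−v|) |v₁−v|^{γ} [ √(μ_M(v₁)) (μ_ε(v)/√(μ_M(v))) g(v₁) − μ_ε(v₁') (√(μ_M(v'))/√(μ_M(v))) g(v') − μ_ε(v') (√(μ_M(v₁'))/√(μ_M(v))) g(v₁') ] dω dv₁. Then there exists C > 0, depending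 only on γ, θ_M, α₀, c₁, c₂, C₀, such that for every m ∈ (0,1], every bounded measurable g, and every v ∈ ℝ³: |K^m g(v)| ≤ C m^{3+γ} (1 + |v|²)^{γ/2} ‖g‖_{L^∞}. -/

import Mathlib

open Real MeasureTheory
open scoped RealInnerProductSpace

noncomputable section

/-- The global reference Maxwellian of temperature `θ_M`:
`μ_M(v) = (2πθ_M)^(−3/2) exp(−|v|²/(2θ_M))`. -/
def muM (θM : ℝ) (v : EuclideanSpace ℝ (Fin 3)) : ℝ :=
  (2 * π * θM) ^ (-(3 : ℝ) / 2) * Real.exp (-‖v‖ ^ 2 / (2 * θM))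

/-- The surface measure `dω` on the unit sphere `S² ⊆ ℝ³`. -/
def sphereMeasure : Measure (Metric.sphere (0 : EuclideanSpace ℝ (Fin 3)) 1) :=
  (volume : Measure (EuclideanSpace ℝ (Fin 3))).toSphere

/-- The post-collision velocity `v' = v − ((v−v₁)·ω)ω`. -/
def postV (v v₁ : EuclideanSpace ℝ (Fin 3))
    (ω : Metric.sphere (0 : EuclideanSpace ℝ (Fin 3)) 1) : EuclideanSpace ℝ (Fin 3) :=
  v - ⟪v - v₁, (ω : EuclideanSpace ℝ (Fin 3))⟫ • (ω : EuclideanSpace ℝ (Fin 3))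

/-- The post-collision velocity `v₁' = v₁ + ((v−v₁)·ω)ω`. -/
def postV₁ (v v₁ : EuclideanSpace ℝ (Fin 3))
    (ω : Metric.sphere (0 : EuclideanSpace ℝ (Fin 3)) 1) : EuclideanSpace ℝ (Fin 3) :=
  v₁ + ⟪v - v₁, (ω : EuclideanSpace ℝ (Fin 3))⟫ • (ω : EuclideanSpace ℝ (Fin 3))

/-- The truncated compact part `K^m` of the linearized Boltzmann operator around a local
Maxwellian `μ_ε`, conjugated by the global Maxwellian `μ_M`. -/
def Km (θM γ : ℝ) (με : EuclideanSpace ℝ (Fin 3) → ℝ) (btilde : ℝ → ℝ) (Υ : ℝ → ℝ)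
    (g : EuclideanSpace ℝ (Fin 3) → ℝ) (v : EuclideanSpace ℝ (Fin 3)) : ℝ :=
  ∫ (v₁ : EuclideanSpace ℝ (Fin 3)),
    ∫ (ω : Metric.sphere (0 : EuclideanSpace ℝ (Fin 3)) 1),
      btilde (⟪v - v₁, (ω : EuclideanSpace ℝ (Fin 3))⟫ / ‖v - v₁‖) * Υ ‖v₁ - v‖ *
        ‖v₁ - v‖ ^ γ *
        (Real.sqrt (muM θM v₁) * (με v / Real.sqrt (muM θM v)) * g v₁ -
          με (postV₁ v v₁ ω) * (Real.sqrt (muM θM (postV v v₁ ω)) / Real.sqrt (muM θM v)) *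
            g (postV v v₁ ω) -
          με (postV v v₁ ω) * (Real.sqrt (muM θM (postV₁ v v₁ ω)) / Real.sqrt (muM θM v)) *
            g (postV₁ v v₁ ω)) ∂sphereMeasure

lemma integrable_indicator_ball_norm_rpow {γ : ℝ} (hγ : -3 < γ) :
    Integrable ((Metric.ball (0 : EuclideanSpace ℝ (Fin 3)) 1).indicator fun u => ‖u‖ ^ γ) := by
  rw [integrable_indicator_iff measurableSet_ball,
    integrableOn_fun_norm_addHaar volume (f := fun r : ℝ => r ^ γ)]
  have h := (intervalIntegral.integrableOn_Ioo_rpow_iff (s := 2 + γ) zero_lt_one).2 (by linarith)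
  refine h.congr_fun (fun r hr => ?_) measurableSet_Ioo
  simp [Real.rpow_add hr.1]

/-- A function supported in the ball of radius `R` around `v` and dominated there by
`A |v₁ - v|^γ` has integral of size `R^(3+γ)`. -/
lemma abs_integral_le_of_le_norm_sub_rpow {γ : ℝ} (hγ : -3 < γ) {A R : ℝ} (hR : 0 < R)
    {f : EuclideanSpace ℝ (Fin 3) → ℝ} (v : EuclideanSpace ℝ (Fin 3))
    (hf : ∀ v₁, ‖v₁ - v‖ < R → |f v₁| ≤ A * ‖v₁ - v‖ ^ γ)
    (hf₀ : ∀ v₁, R ≤ ‖v₁ - v‖ → f v₁ = 0) :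
    |∫ v₁, f v₁| ≤ A * (R ^ (3 + γ) *
      ∫ u, (Metric.ball (0 : EuclideanSpace ℝ (Fin 3)) 1).indicator (fun u => ‖u‖ ^ γ) u) := by
  set F : EuclideanSpace ℝ (Fin 3) → ℝ :=
    (Metric.ball (0 : EuclideanSpace ℝ (Fin 3)) 1).indicator fun u => ‖u‖ ^ γ with hF
  have hint : Integrable F := integrable_indicator_ball_norm_rpow hγ
  have hsmul : Integrable fun u => F (R⁻¹ • u) := hint.comp_smul (inv_ne_zero hR.ne')
  have hdom : Integrable fun v₁ => A * R ^ γ * F (R⁻¹ • (v₁ - v)) :=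
    (hsmul.comp_sub_right v).const_mul _
  refine (norm_integral_le_of_norm_le (G := ℝ) hdom (.of_forall fun v₁ => ?_)).trans_eq ?_
  · rw [Real.norm_eq_abs]
    have hnorm : ‖R⁻¹ • (v₁ - v)‖ = R⁻¹ * ‖v₁ - v‖ := by
      rw [norm_smul, Real.norm_of_nonneg (inv_nonneg.2 hR.le)]
    rcases lt_or_ge ‖v₁ - v‖ R with h | h
    · have hmem : R⁻¹ • (v₁ - v) ∈ Metric.ball (0 : EuclideanSpace ℝ (Fin 3)) 1 := by
        rw [mem_ball_zero_iff, hnorm, inv_mul_lt_iff₀ hR, mul_one]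
        exact h
      rw [hF, Set.indicator_of_mem hmem, hnorm,
        Real.mul_rpow (inv_nonneg.2 hR.le) (norm_nonneg _), Real.inv_rpow hR.le]
      refine (hf v₁ h).trans_eq ?_
      have := (Real.rpow_pos_of_pos hR γ).ne'
      field_simp
    · have hmem : R⁻¹ • (v₁ - v) ∉ Metric.ball (0 : EuclideanSpace ℝ (Fin 3)) 1 := by
        rw [mem_ball_zero_iff, hnorm, inv_mul_lt_iff₀ hR, mul_one]
        exact h.not_gt
      rw [hf₀ v₁ h, hF, Set.indicator_of_notMem hmem]
      simp
  · rw [integral_const_mul, integral_sub_right_eq_self (fun u => F (R⁻¹ • u)) v,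
      Measure.integral_comp_inv_smul_of_nonneg volume F hR.le, Real.rpow_add hR]
    simp only [finrank_euclideanSpace, Fintype.card_fin, smul_eq_mul]
    norm_cast
    ring

lemma muM_pos {θM : ℝ} (hθM : 0 < θM) (v : EuclideanSpace ℝ (Fin 3)) : 0 < muM θM v := by
  unfold muM
  positivity

lemma muM_rpow_mul_sqrt_div_sqrt {θM : ℝ} (hθM : 0 < θM) (α : ℝ)
    (x y v : EuclideanSpace ℝ (Fin 3)) :
    muM θM x ^ α * (√(muM θM y) / √(muM θM v)) =
      ((2 * π * θM) ^ (-(3 : ℝ) / 2)) ^ α *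
        Real.exp (-(α * ‖x‖ ^ 2 + ‖y‖ ^ 2 / 2 - ‖v‖ ^ 2 / 2) / (2 * θM)) := by
  have hM : 0 < (2 * π * θM) ^ (-(3 : ℝ) / 2) := by positivity
  unfold muM
  rw [← Real.sqrt_div (by positivity), mul_div_mul_left _ _ hM.ne', ← Real.exp_sub,
    Real.sqrt_eq_rpow, ← Real.exp_mul, Real.mul_rpow hM.le (Real.exp_pos _).le, ← Real.exp_mul,
    mul_assoc, ← Real.exp_add]
  congr 2
  field_simp
  ring

lemma abs_mul_sqrt_muM_div_mul_le {θM α₀ c₁ c₂ : ℝ} (hθM : 0 < θM) (hc₁ : 0 < c₁) (hc₂ : 0 < c₂)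
    {με g : EuclideanSpace ℝ (Fin 3) → ℝ} {B : ℝ}
    (hμ₁ : ∀ v, c₁ * muM θM v ≤ με v) (hμ₂ : ∀ v, με v ≤ c₂ * muM θM v ^ α₀)
    (hg : ∀ v, |g v| ≤ B) {x y v : EuclideanSpace ℝ (Fin 3)}
    (h : (α₀ - 1 / 2) / 2 * ‖v‖ ^ 2 - 2 ≤ α₀ * ‖x‖ ^ 2 + ‖y‖ ^ 2 / 2 - ‖v‖ ^ 2 / 2) :
    |με x * (√(muM θM y) / √(muM θM v)) * g y| ≤
      c₂ * ((2 * π * θM) ^ (-(3 : ℝ) / 2)) ^ α₀ * Real.exp (1 / θM) *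
        Real.exp (-((α₀ - 1 / 2) / (4 * θM) * ‖v‖ ^ 2)) * B := by
  have hμ₀ : 0 ≤ με x := (mul_pos hc₁ (muM_pos hθM x)).le.trans (hμ₁ x)
  have hr : 0 ≤ √(muM θM y) / √(muM θM v) := by positivity
  rw [abs_mul, abs_of_nonneg (mul_nonneg hμ₀ hr)]
  refine mul_le_mul ?_ (hg y) (abs_nonneg _) (by positivity)
  calc με x * (√(muM θM y) / √(muM θM v))
      ≤ c₂ * muM θM x ^ α₀ * (√(muM θM y) / √(muM θM v)) :=
        mul_le_mul_of_nonneg_right (hμ₂ x) hr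
    _ = c₂ * ((2 * π * θM) ^ (-(3 : ℝ) / 2)) ^ α₀ *
          Real.exp (-(α₀ * ‖x‖ ^ 2 + ‖y‖ ^ 2 / 2 - ‖v‖ ^ 2 / 2) / (2 * θM)) := by
        rw [mul_assoc, muM_rpow_mul_sqrt_div_sqrt hθM, ← mul_assoc]
    _ ≤ _ := by
        rw [mul_assoc _ (Real.exp _) (Real.exp _), ← Real.exp_add]
        refine mul_le_mul_of_nonneg_left (Real.exp_le_exp.2 ?_) (by positivity)
        rw [div_le_iff₀ (by positivity)]
        field_simp
        linarith

lemma norm_postV_sq_add_norm_postV₁_sq (v v₁ : EuclideanSpace ℝ (Fin 3))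
    (ω : Metric.sphere (0 : EuclideanSpace ℝ (Fin 3)) 1) :
    ‖postV v v₁ ω‖ ^ 2 + ‖postV₁ v v₁ ω‖ ^ 2 = ‖v‖ ^ 2 + ‖v₁‖ ^ 2 := by
  have hω : ‖(ω : EuclideanSpace ℝ (Fin 3))‖ = 1 := norm_eq_of_mem_sphere ω
  unfold postV postV₁
  rw [norm_sub_sq_real, norm_add_sq_real, norm_smul, hω, inner_smul_right, inner_smul_right,
    inner_sub_left, mul_one, Real.norm_eq_abs, sq_abs]
  ring

/-- Gaussian decay beats every power that is at least `-2`. -/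
lemma exp_neg_mul_le_one_add_rpow {κ p x : ℝ} (hκ : 0 < κ) (hp : -2 ≤ p) (hx : 0 ≤ x) :
    Real.exp (-(κ * x)) ≤ (1 + 2 / κ) ^ 2 * (1 + x) ^ p := by
  have hlin : 1 + x ≤ (1 + 2 / κ) * Real.exp (κ * x / 2) := by
    have hexp := Real.add_one_le_exp (κ * x / 2)
    calc 1 + x ≤ (1 + 2 / κ) * (κ * x / 2 + 1) := by
          have : (1 + 2 / κ) * (κ * x / 2 + 1) = 1 + x + (κ * x / 2 + 2 / κ) := by
            field_simp
            ring
          rw [this]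
          have : 0 ≤ κ * x / 2 + 2 / κ := by positivity
          linarith
      _ ≤ _ := mul_le_mul_of_nonneg_left hexp (by positivity)
  have hsq : (1 + x) ^ 2 ≤ (1 + 2 / κ) ^ 2 * Real.exp (κ * x) := by
    calc (1 + x) ^ 2 ≤ ((1 + 2 / κ) * Real.exp (κ * x / 2)) ^ 2 :=
          pow_le_pow_left₀ (by positivity) hlin 2
      _ = _ := by
          rw [mul_pow, ← Real.exp_nat_mul]
          congr 2
          push_cast
          ring
  have hpow : ((1 + x) ^ 2)⁻¹ ≤ (1 + x) ^ p := by
    calc ((1 + x) ^ 2)⁻¹ = (1 + x) ^ (-2 : ℝ) := by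
          rw [Real.rpow_neg (by positivity)]
          norm_cast
      _ ≤ _ := Real.rpow_le_rpow_of_exponent_le (by linarith) hp
  refine le_trans ?_ (mul_le_mul_of_nonneg_left hpow (by positivity))
  rw [Real.exp_neg, ← div_eq_mul_inv, inv_le_iff_one_le_mul₀ (Real.exp_pos _), mul_comm,
    ← mul_div_assoc, one_le_div (by positivity), mul_comm]
  exact hsq

/-- Estimate for the small-relative-velocity truncation of the compact part of the linearized
Boltzmann operator: `|K^m g(v)| ≤ C m^{3+γ} (1+|v|²)^{γ/2} ‖g‖_∞`, with `C` depending only on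
`γ, θ_M, α₀, c₁, c₂, C₀`. -/
theorem Km_smallness
    (γ θM α₀ c₁ c₂ C₀ : ℝ)
    (hγ₁ : -3 < γ) (hγ₂ : γ ≤ 1) (hθM : 0 < θM)
    (hα₀ : 1 / 2 < α₀) (hα₀' : α₀ < 1) (hc₁ : 0 < c₁) (hc₂ : 0 < c₂) (hC₀ : 0 < C₀) :
    ∃ C > (0 : ℝ),
      ∀ με : EuclideanSpace ℝ (Fin 3) → ℝ, Measurable με →
      (∀ v, c₁ * muM θM v ≤ με v) → (∀ v, με v ≤ c₂ * (muM θM v) ^ α₀) →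
      ∀ btilde : ℝ → ℝ, Measurable btilde → (∀ s, 0 ≤ btilde s) →
        (∀ s, btilde s ≤ C₀ * |s|) →
      ∀ m : ℝ, 0 < m → m ≤ 1 →
      ∀ Υ : ℝ → ℝ, Measurable Υ → (∀ s, 0 ≤ Υ s) → (∀ s, Υ s ≤ 1) →
        (∀ s, s ≤ m → Υ s = 1) → (∀ s, 2 * m ≤ s → Υ s = 0) →
      ∀ g : EuclideanSpace ℝ (Fin 3) → ℝ, Measurable g →
      ∀ B : ℝ, (∀ v, |g v| ≤ B) →
      ∀ v : EuclideanSpace ℝ (Fin 3),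
        |Km θM γ με btilde Υ g v| ≤ C * m ^ (3 + γ) * (1 + ‖v‖ ^ 2) ^ (γ / 2) * B := by
  set S : ℝ := sphereMeasure.real Set.univ
  set J : ℝ := ∫ u, (Metric.ball (0 : EuclideanSpace ℝ (Fin 3)) 1).indicator
    (fun u => ‖u‖ ^ γ) u
  set κ : ℝ := (α₀ - 1 / 2) / (4 * θM)
  set D : ℝ := c₂ * ((2 * π * θM) ^ (-(3 : ℝ) / 2)) ^ α₀ * Real.exp (1 / θM)
  have hκ : 0 < κ := div_pos (by linarith) (by positivity)
  have hD₀ : 0 < D := by positivity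
  have hJ₀ : 0 ≤ J := integral_nonneg fun u =>
    Set.indicator_nonneg (fun u _ => by positivity) u
  set C : ℝ := C₀ * (3 * (D * (1 + 2 / κ) ^ 2)) * S * 2 ^ (3 + γ) * J with hC
  have hS₀ : 0 ≤ S := measureReal_nonneg
  have hCnn : 0 ≤ C := by positivity
  refine ⟨C + 1, by linarith, ?_⟩
  intro με _ hμ₁ hμ₂ btilde _ hb₀ hb m hm hm₁ Υ _ hΥ₀ hΥ₁ _ hΥ g _ B hg v
  have hB : 0 ≤ B := (abs_nonneg _).trans (hg 0)
  have hW : Real.exp (-(κ * ‖v‖ ^ 2)) ≤ (1 + 2 / κ) ^ 2 * (1 + ‖v‖ ^ 2) ^ (γ / 2) :=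
    exp_neg_mul_le_one_add_rpow hκ (by linarith) (by positivity)
  set W : ℝ := (1 + ‖v‖ ^ 2) ^ (γ / 2)
  have hW₀ : 0 ≤ W := by positivity
  set E : ℝ := D * Real.exp (-(κ * ‖v‖ ^ 2)) * B with hE
  have hE₀ : 0 ≤ E := by positivity
  have hfin : IsFiniteMeasure sphereMeasure := by
    unfold sphereMeasure
    infer_instance
  have hmain : |Km θM γ με btilde Υ g v| ≤ C₀ * (3 * E) * S * ((2 * m) ^ (3 + γ) * J) := by
    refine abs_integral_le_of_le_norm_sub_rpow hγ₁ (by positivity : 0 < 2 * m) v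
      (fun v₁ hv₁ => ?_) (fun v₁ hv₁ => by simp [hΥ _ hv₁])
    rw [← Real.norm_eq_abs, mul_right_comm _ S]
    refine norm_integral_le_of_norm_le_const (G := ℝ) (μ := sphereMeasure) (.of_forall fun ω => ?_)
    have hnear : ‖v‖ ≤ ‖v₁‖ + 2 := by
      have := norm_sub_norm_le v v₁
      rw [norm_sub_rev] at this
      linarith
    have hsq : ‖v‖ ^ 2 / 4 - 2 ≤ ‖v₁‖ ^ 2 / 2 := by
      nlinarith [norm_nonneg v, norm_nonneg v₁, sq_nonneg (‖v₁‖ - 2)]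
    have hcons := norm_postV_sq_add_norm_postV₁_sq v v₁ ω
    have hloss : |με v * (√(muM θM v₁) / √(muM θM v)) * g v₁| ≤ E :=
      abs_mul_sqrt_muM_div_mul_le hθM hc₁ hc₂ hμ₁ hμ₂ hg (by
        nlinarith [sq_nonneg ‖v‖, sq_nonneg ‖v₁‖])
    have hgain {x y : EuclideanSpace ℝ (Fin 3)}
        (hxy : ‖x‖ ^ 2 + ‖y‖ ^ 2 = ‖v‖ ^ 2 + ‖v₁‖ ^ 2) :
        |με x * (√(muM θM y) / √(muM θM v)) * g y| ≤ E :=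
      abs_mul_sqrt_muM_div_mul_le hθM hc₁ hc₂ hμ₁ hμ₂ hg (by
        nlinarith [sq_nonneg ‖v‖, sq_nonneg ‖x‖])
    have hbt : btilde (⟪v - v₁, (ω : EuclideanSpace ℝ (Fin 3))⟫ / ‖v - v₁‖) ≤ C₀ := by
      refine (hb _).trans (mul_le_of_le_one_right hC₀.le ?_)
      rw [abs_div, abs_norm]
      refine div_le_one_of_le₀ ?_ (norm_nonneg _)
      simpa using abs_real_inner_le_norm (v - v₁) (ω : EuclideanSpace ℝ (Fin 3))
    have hpow : 0 ≤ ‖v₁ - v‖ ^ γ := by positivity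
    rw [norm_mul, Real.norm_of_nonneg (mul_nonneg (mul_nonneg (hb₀ _) (hΥ₀ _)) hpow),
      mul_right_comm C₀]
    refine mul_le_mul ?_ ?_ (norm_nonneg _) (by positivity)
    · refine mul_le_mul_of_nonneg_right ?_ hpow
      exact (mul_le_of_le_one_right (hb₀ _) (hΥ₁ _)).trans hbt
    · rw [Real.norm_eq_abs, mul_div_left_comm]
      refine (abs_sub _ _).trans ((add_le_add_left (abs_sub _ _) _).trans ?_)
      have h₂ := hgain (x := postV₁ v v₁ ω) (y := postV v v₁ ω) (by linarith)
      have h₃ := hgain hcons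
      linarith
  refine hmain.trans ?_
  have hEW : E ≤ D * (1 + 2 / κ) ^ 2 * W * B := by
    rw [hE, mul_assoc D _ W]
    gcongr
  have hrest : 0 ≤ m ^ (3 + γ) * W * B := by positivity
  calc C₀ * (3 * E) * S * ((2 * m) ^ (3 + γ) * J)
      ≤ C₀ * (3 * (D * (1 + 2 / κ) ^ 2 * W * B)) * S * ((2 * m) ^ (3 + γ) * J) := by gcongr
    _ = C * (m ^ (3 + γ) * W * B) := by
        rw [Real.mul_rpow zero_le_two hm.le, hC]
        ring
    _ ≤ (C + 1) * (m ^ (3 + γ) * W * B) := by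
        gcongr
        linarith
    _ = (C + 1) * m ^ (3 + γ) * W * B := by ring
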